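/- Let α ∈ (0,2) and let m = 2r, n = 2s be even nonnegative integers. Then b_{mn} := ∫_{-1}^1 (1-x²)^α P_m^{(α/2)}(x) P_n^{(α/2)}(x) dx = (-1)^{(m-n)/2} Γ(α+1) Γ((m+n+1)/2) Γ(α/2+1)² / (Γ((α-m+n)/2+1) Γ((α-n+m)/2+1) Γ((m+n+3)/2+α)). -/

import Mathlib

open Real Finset

/-- Rising factorial (Pochhammer symbol) for a real argument. -/
noncomputable def poch (a : ℝ) (k : ℕ) : ℝ := ∏ j ∈ Finset.range k, (a + j)

/-- Jacobi polynomial `P_n^{(β,γ)}` normalized so that `P_n^{(β,γ)}(1) = 1`,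
i.e. `P_n^{(β,γ)}(x) = ₂F₁(-n, n+β+γ+1; β+1; (1-x)/2)`. -/
noncomputable def jacobiP (β γ : ℝ) (n : ℕ) (x : ℝ) : ℝ :=
  ∑ k ∈ Finset.range (n + 1),
    ((-1 : ℝ) ^ k * (n.choose k) * poch ((n : ℝ) + β + γ + 1) k / poch (β + 1) k) *
      ((1 - x) / 2) ^ k


/-- coefficients in t = (1-x)/2 -/
noncomputable def jc (α : ℝ) (n k : ℕ) : ℝ :=
  (-1 : ℝ) ^ k * (n.choose k) * poch ((n : ℝ) + α / 2 + α / 2 + 1) k / poch (α / 2 + 1) k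

noncomputable def jp (α : ℝ) (n : ℕ) : Polynomial ℝ :=
  ∑ k ∈ Finset.range (n + 1), Polynomial.C (jc α n k) * Polynomial.X ^ k

theorem jp_eval (α : ℝ) (n : ℕ) (x : ℝ) :
    (jp α n).eval ((1 - x) / 2) = jacobiP (α / 2) (α / 2) n x := by
  simp [jp, jacobiP, Polynomial.eval_finsetSum, jc]

theorem jp_coeff (α : ℝ) (n k : ℕ) : (jp α n).coeff k = jc α n k := by
  simp only [jp, Polynomial.finsetSum_coeff, Polynomial.coeff_C_mul_X_pow]
  rw [Finset.sum_ite_eq]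
  split_ifs with h
  · rfl
  · have : n < k := by simpa using h
    simp [jc, Nat.choose_eq_zero_of_lt this]

theorem poch_succ (a : ℝ) (k : ℕ) : poch a (k + 1) = poch a k * (a + k) := by
  simp [poch, Finset.prod_range_succ]

theorem poch_succ' (a : ℝ) (k : ℕ) : poch a (k + 1) = a * poch (a + 1) k := by
  simp only [poch, Finset.prod_range_succ']
  rw [mul_comm]
  congr 1
  · simp
  · apply Finset.prod_congr rfl
    intro j _
    push_cast; ring

theorem poch_pos (a : ℝ) (ha : 0 < a) (k : ℕ) : 0 < poch a k := by
  apply Finset.prod_pos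
  intro j _
  positivity

theorem jc_zero (α : ℝ) (n : ℕ) : jc α n 0 = 1 := by simp [jc, poch]

/-- core common quantity -/
noncomputable def jd (α : ℝ) (n k : ℕ) : ℝ :=
  (-1 : ℝ) ^ k * (n.choose k) / (k + 1) * poch ((n : ℝ) + α + 1) k / poch (α / 2 + 1) (k + 1)

theorem choose_succ_real (n k : ℕ) :
    ((n.choose (k + 1) : ℕ) : ℝ) = (n.choose k) * ((n : ℝ) - k) / (k + 1) := by
  have h := Nat.choose_succ_right_eq n k
  rw [eq_div_iff (by positivity)]
  rcases le_or_gt k n with hk | hk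
  · have : ((n - k : ℕ) : ℝ) = (n : ℝ) - k := by push_cast [hk]; ring
    rw [← this]; exact_mod_cast h
  · rw [Nat.choose_eq_zero_of_lt hk, Nat.choose_eq_zero_of_lt (by omega)]; simp


theorem jc_a (α : ℝ) (hα : 0 < α) (n k : ℕ) : jc α n k = jd α n k * ((k + 1) * (α / 2 + 1 + k)) := by
  have h1 := (poch_pos (α / 2 + 1) (by positivity) k).ne'
  have h2 : (α / 2 + 1 + k) ≠ 0 := by positivity
  have h3 : (k + 1 : ℝ) ≠ 0 := by positivity
  have e : (n : ℝ) + α / 2 + α / 2 + 1 = n + α + 1 := by ring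
  simp only [jc, jd, poch_succ, e]
  field_simp

theorem jc_b (α : ℝ) (hα : 0 < α) (n k : ℕ) :
    jc α n (k + 1) = - jd α n k * ((n - k) * (n + α + 1 + k)) := by
  have h1 := (poch_pos (α / 2 + 1) (by positivity) k).ne'
  have h2 : (α / 2 + 1 + k) ≠ 0 := by positivity
  have h3 : (k + 1 : ℝ) ≠ 0 := by positivity
  have e : (n : ℝ) + α / 2 + α / 2 + 1 = n + α + 1 := by ring
  simp only [jc, jd, poch_succ, e, choose_succ_real]
  field_simp
  ring

theorem jc_c (α : ℝ) (hα : 0 < α) (n k : ℕ) :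
    (n + α + 1) * jc α (n + 1) (k + 1) =
      - jd α n k * ((n + 1) * (n + α + 1 + k) * (n + α + 2 + k)) := by
  have h1 := (poch_pos (α / 2 + 1) (by positivity) k).ne'
  have h2 : (α / 2 + 1 + k) ≠ 0 := by positivity
  have h3 : (k + 1 : ℝ) ≠ 0 := by positivity
  have e : ((n + 1 : ℕ) : ℝ) + α / 2 + α / 2 + 1 = (n + α + 1) + 1 := by push_cast; ring
  have e2 := poch_succ' (n + α + 1) (k + 1)
  have e3 : (((n + 1).choose (k + 1) : ℕ) : ℝ) = (n + 1) * n.choose k / (k + 1) := by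
    rw [eq_div_iff h3]; exact_mod_cast (Nat.add_one_mul_choose_eq n k).symm
  have : (n + α + 1) * jc α (n + 1) (k + 1) = (-1 : ℝ) ^ (k + 1) * ((n + 1).choose (k + 1) : ℕ)
      * ((n + α + 1) * poch (n + α + 1 + 1) (k + 1)) / poch (α / 2 + 1) (k + 1) := by
    simp only [jc, e]; ring
  rw [this, ← e2, e3]
  simp only [jd, poch_succ]
  push_cast
  field_simp
  ring

theorem jc_d (α : ℝ) (hα : 0 < α) (n k : ℕ) :
    n * jc α (n - 1) (k + 1) =
      - jd α n k * ((n - k) * (n - k - 1) * (n + α)) := by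
  rcases n with _ | n
  · rcases k with _ | k
    · simp
    · simp [jd]
  have h1 := (poch_pos (α / 2 + 1) (by positivity) k).ne'
  have h2 : (α / 2 + 1 + k) ≠ 0 := by positivity
  have h3 : (k + 1 : ℝ) ≠ 0 := by positivity
  have e : ((n : ℕ) : ℝ) + α / 2 + α / 2 + 1 = (n + α + 1) := by ring
  have e4 : (((n + 1 : ℕ) : ℝ) + α + 1) = (n + α + 1 + 1) := by push_cast; ring
  have e3 : (n + 1) * ((n.choose (k + 1) : ℕ) : ℝ) =
      ((n + 1).choose k : ℕ) * ((n : ℝ) + 1 - k) * (n - k) / (k + 1) := by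
    have h5 : (n + 1 : ℝ) * (n.choose (k + 1) : ℕ) = ((n+1).choose (k+2) : ℕ) * (k + 2) := by
      exact_mod_cast Nat.add_one_mul_choose_eq n (k + 1)
    rw [h5, choose_succ_real, choose_succ_real]
    push_cast
    field_simp
    ring
  have : ((n + 1 : ℕ) : ℝ) * jc α (n + 1 - 1) (k + 1) = (-1 : ℝ) ^ (k + 1) *
      ((n + 1) * ((n.choose (k + 1) : ℕ) : ℝ))
      * (poch (n + α + 1) (k + 1)) / poch (α / 2 + 1) (k + 1) := by
    simp only [jc, e, Nat.add_sub_cancel]; push_cast; ring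
  rw [this, e3, poch_succ']
  simp only [jd, poch_succ, e4]
  push_cast
  field_simp
  ring

open Polynomial in
theorem jp_rec (α : ℝ) (hα : 0 < α) (n : ℕ) :
    C (2 * n + α + 1) * ((1 - 2 * X) * jp α n) =
      C (n + α + 1) * jp α (n + 1) + C (n : ℝ) * jp α (n - 1) := by
  have e : (1 - 2 * X) * jp α n = jp α n - C 2 * (X * jp α n) := by
    rw [show (C 2 : ℝ[X]) = 2 from rfl]; ring
  rw [e]
  ext k
  rcases k with _ | k
  · simp [jp_coeff, jc_zero, mul_coeff_zero]; ring
  · simp only [coeff_add, coeff_sub, coeff_C_mul, coeff_X_mul, jp_coeff]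
    rw [jc_c α hα, jc_d α hα, jc_a α hα n k, jc_b α hα]
    ring

open Polynomial in
theorem jp_der (α : ℝ) (hα : 0 < α) (n : ℕ) :
    C (-2) * (X * (1 - X) * derivative (jp α n)) =
      C (n : ℝ) * jp α (n - 1) - C (n : ℝ) * ((1 - 2 * X) * jp α n) := by
  have e : (1 - 2 * X) * jp α n = jp α n - C 2 * (X * jp α n) := by
    rw [show (C 2 : ℝ[X]) = 2 from rfl]; ring
  have e' : X * (1 - X) * derivative (jp α n) =
      X * derivative (jp α n) - X * (X * derivative (jp α n)) := by ring
  rw [e, e']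
  ext k
  rcases k with _ | k
  · simp [jp_coeff, jc_zero, mul_coeff_zero]
  · have hX : (X * derivative (jp α n)).coeff k = k * jc α n k := by
      rcases k with _ | k
      · simp
      · rw [coeff_X_mul, coeff_derivative, jp_coeff]; push_cast; ring
    simp only [coeff_sub, coeff_C_mul, coeff_X_mul, jp_coeff, hX, coeff_derivative]
    rw [jc_d α hα, jc_a α hα n k, jc_b α hα]
    ring


/-- the weighted integral functional -/
noncomputable def jI (α : ℝ) (f : Polynomial ℝ) : ℝ :=
  ∫ x in (-1 : ℝ)..1, (1 - x ^ 2) ^ α * f.eval ((1 - x) / 2)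

theorem jI_int (α : ℝ) (hα : 0 < α) (f : Polynomial ℝ) :
    IntervalIntegrable (fun x : ℝ => (1 - x ^ 2) ^ α * f.eval ((1 - x) / 2))
      MeasureTheory.volume (-1) 1 := by
  apply Continuous.intervalIntegrable
  apply Continuous.mul
  · exact Continuous.rpow_const (by fun_prop) (fun x => Or.inr hα.le)
  · exact f.continuous.comp (by fun_prop)

theorem jI_add (α : ℝ) (hα : 0 < α) (f g : Polynomial ℝ) :
    jI α (f + g) = jI α f + jI α g := by
  unfold jI
  rw [← intervalIntegral.integral_add (jI_int α hα f) (jI_int α hα g)]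
  congr 1; ext x; simp; ring

theorem jI_sub (α : ℝ) (hα : 0 < α) (f g : Polynomial ℝ) :
    jI α (f - g) = jI α f - jI α g := by
  unfold jI
  rw [← intervalIntegral.integral_sub (jI_int α hα f) (jI_int α hα g)]
  congr 1; ext x; simp; ring

theorem jI_C (α : ℝ) (c : ℝ) (f : Polynomial ℝ) :
    jI α (Polynomial.C c * f) = c * jI α f := by
  unfold jI
  rw [← intervalIntegral.integral_const_mul]
  congr 1; ext x; simp; ring

open Polynomial in
theorem jI_parts (α : ℝ) (hα : 0 < α) (g : Polynomial ℝ) :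
    jI α (C (-2) * (X * (1 - X) * derivative g)) = 2 * (α + 1) * jI α ((1 - 2 * X) * g) := by
  rw [← jI_C, ← sub_eq_zero, ← jI_sub α hα]
  have hd : ∀ x ∈ Set.uIcc (-1 : ℝ) 1, HasDerivAt
      (fun x : ℝ => (1 - x ^ 2) ^ (α + 1) * g.eval ((1 - x) / 2))
      ((1 - x ^ 2) ^ α * (C (-2) * (X * (1 - X) * derivative g) -
        C (2 * (α + 1)) * ((1 - 2 * X) * g)).eval ((1 - x) / 2)) x := by
    intro x hx
    rw [Set.uIcc_of_le (by norm_num)] at hx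
    have h0 : 0 ≤ 1 - x ^ 2 := by nlinarith [hx.1, hx.2]
    have h1 : HasDerivAt (fun x : ℝ => 1 - x ^ 2) (-(2 * x)) x := by
      simpa using (hasDerivAt_pow 2 x).const_sub 1
    have h2 := h1.rpow_const (p := α + 1) (Or.inr (by linarith))
    have h3 : HasDerivAt (fun x : ℝ => (1 - x) / 2) (-1 / 2) x := by
      simpa using ((hasDerivAt_id x).const_sub 1).div_const 2
    have h4 := (g.hasDerivAt ((1 - x) / 2)).comp x h3
    have h5 := h2.mul h4
    refine h5.congr_deriv ?_
    have h6 : (1 - x ^ 2) ^ (α + 1) = (1 - x ^ 2) ^ α * (1 - x ^ 2) := by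
      rw [Real.rpow_add_one' h0 (by linarith)]
    simp only [Function.comp, h6, add_sub_cancel_right, eval_sub, eval_mul, eval_C, eval_X,
      eval_one, eval_ofNat]
    ring
  have := intervalIntegral.integral_eq_sub_of_hasDerivAt hd (jI_int α hα _)
  rw [jI, this]
  have : α + 1 ≠ 0 := by linarith
  simp [Real.zero_rpow this]

theorem jI_zero (α : ℝ) (hα : 0 < α) :
    jI α 1 = Real.Gamma (α + 1) * Real.Gamma (1 / 2) / Real.Gamma (α + 3 / 2) := by
  have hb := ProbabilityTheory.beta_eq_betaIntegralReal (α + 1) (α + 1) (by linarith) (by linarith)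
  have h1 : Complex.betaIntegral (α + 1 : ℝ) (α + 1 : ℝ) =
      ((∫ t in (0 : ℝ)..1, t ^ α * (1 - t) ^ α : ℝ) : ℂ) := by
    rw [Complex.betaIntegral, ← intervalIntegral.integral_ofReal]
    apply intervalIntegral.integral_congr
    intro t ht
    rw [Set.uIcc_of_le (by norm_num)] at ht
    have h3 : 0 ≤ 1 - t := by linarith [ht.2]
    simp only [Complex.ofReal_mul, Complex.ofReal_cpow ht.1, Complex.ofReal_cpow h3]
    push_cast
    simp
  rw [h1, Complex.ofReal_re] at hb
  have h2 : jI α 1 = 2 * ∫ t in (0 : ℝ)..1, (4 : ℝ) ^ α * (t ^ α * (1 - t) ^ α) := by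
    have h4 := intervalIntegral.integral_comp_mul_sub (a := 0) (b := 1)
      (fun x : ℝ => (1 - x ^ 2) ^ α) (c := 2) (by norm_num) 1
    have h5 : jI α 1 = ∫ x in (2 * 0 - 1 : ℝ)..(2 * 1 - 1), (1 - x ^ 2) ^ α := by
      unfold jI; norm_num
    have h6 : ∫ t in (0 : ℝ)..1, (4 : ℝ) ^ α * (t ^ α * (1 - t) ^ α) =
        ∫ t in (0 : ℝ)..1, (1 - (2 * t - 1) ^ 2) ^ α := by
      apply intervalIntegral.integral_congr
      intro t ht
      rw [Set.uIcc_of_le (by norm_num)] at ht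
      have h3 : 0 ≤ 1 - t := by linarith [ht.2]
      simp only
      rw [← Real.mul_rpow ht.1 h3, ← Real.mul_rpow (by norm_num) (mul_nonneg ht.1 h3)]
      congr 1; ring
    rw [h6, h4, h5, smul_eq_mul]; ring
  rw [h2, intervalIntegral.integral_const_mul, ← hb, ProbabilityTheory.beta]
  have hdup := Real.Gamma_mul_Gamma_add_half (α + 1)
  rw [Real.Gamma_one_half_eq]
  have g1 := (Real.Gamma_pos_of_pos (show 0 < α + 1 by linarith)).ne'
  have g2 := (Real.Gamma_pos_of_pos (show 0 < α + 3 / 2 by linarith)).ne'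
  have g3 := (Real.Gamma_pos_of_pos (show 0 < α + 1 + (α + 1) by linarith)).ne'
  rw [show α + 1 + 1 / 2 = α + 3 / 2 by ring, show 2 * (α + 1) = α + 1 + (α + 1) by ring] at hdup
  have h7 : (2 : ℝ) * 4 ^ α * 2 ^ (1 - (α + 1 + (α + 1))) = 1 := by
    rw [show (4 : ℝ) = 2 ^ (2 : ℝ) by norm_num, ← Real.rpow_mul (by norm_num),
      mul_assoc, ← Real.rpow_add (by norm_num)]
    rw [show 2 * α + (1 - (α + 1 + (α + 1))) = -1 by ring, Real.rpow_neg_one]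
    norm_num
  rw [eq_div_iff g2]
  generalize Real.Gamma (α + 1 + (α + 1)) = A at *
  generalize Real.Gamma (α + 3 / 2) = B at *
  generalize Real.Gamma (α + 1) = D at *
  generalize (2 : ℝ) ^ (1 - (α + 1 + (α + 1))) = E at *
  generalize (4 : ℝ) ^ α = G at *
  field_simp
  linear_combination (2 * G) * hdup + (A * √π) * h7

/-- closed form, with `m + n = 2k`, `m - n = 2e` -/
noncomputable def jF (α : ℝ) (k : ℕ) (e : ℤ) : ℝ :=
  (-1 : ℝ) ^ e * Real.Gamma (α + 1) * Real.Gamma ((k : ℝ) + 1 / 2) * Real.Gamma (α / 2 + 1) ^ 2 /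
    (Real.Gamma (α / 2 - e + 1) * Real.Gamma (α / 2 + e + 1) * Real.Gamma ((k : ℝ) + 3 / 2 + α))

theorem half_ne (α : ℝ) (h0 : 0 < α) (h2 : α < 2) (z : ℤ) : α / 2 + z ≠ 0 := by
  intro h
  have h1 : (-1 : ℝ) < z := by linarith
  have h3 : (z : ℝ) < 0 := by linarith
  have : (-1 : ℤ) < z := by exact_mod_cast h1
  have : z < (0 : ℤ) := by exact_mod_cast h3
  omega

theorem gam_ne (α : ℝ) (h0 : 0 < α) (h2 : α < 2) (z : ℤ) : Real.Gamma (α / 2 + z) ≠ 0 := by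
  apply Real.Gamma_ne_zero
  intro m h
  apply half_ne α h0 h2 (z + m)
  push_cast; linarith

theorem jF_k (α : ℝ) (h0 : 0 < α) (h2 : α < 2) (k : ℕ) (e : ℤ) :
    jF α (k + 1) e = jF α k e * ((k + 1 / 2) / (k + 3 / 2 + α)) := by
  have a1 : (k : ℝ) + 1 / 2 ≠ 0 := by positivity
  have a2 : (k : ℝ) + 3 / 2 + α ≠ 0 := by positivity
  unfold jF
  rw [show ((k + 1 : ℕ) : ℝ) + 1 / 2 = (k + 1 / 2) + 1 by push_cast; ring,
    show ((k + 1 : ℕ) : ℝ) + 3 / 2 + α = (k + 3 / 2 + α) + 1 by push_cast; ring,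
    Real.Gamma_add_one a1, Real.Gamma_add_one a2]
  rw [div_mul_div_comm]
  congr 1 <;> ring

theorem jF_e (α : ℝ) (h0 : 0 < α) (h2 : α < 2) (k : ℕ) (e : ℤ) :
    jF α k (e + 1) = - jF α k e * ((α / 2 - e) / (α / 2 + e + 1)) := by
  have a1 : α / 2 - e ≠ 0 := by
    have := half_ne α h0 h2 (-e); push_cast at this; rwa [sub_eq_add_neg]
  have a2 : α / 2 + e + 1 ≠ 0 := by
    have := half_ne α h0 h2 (e + 1); push_cast at this; rwa [add_assoc]
  have b1 : Real.Gamma (α / 2 - e) ≠ 0 := by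
    have := gam_ne α h0 h2 (-e); push_cast at this; rwa [sub_eq_add_neg]
  have b2 : Real.Gamma (α / 2 + e + 1) ≠ 0 := by
    have := gam_ne α h0 h2 (e + 1); push_cast at this; rwa [add_assoc]
  have b3 : Real.Gamma ((k : ℝ) + 3 / 2 + α) ≠ 0 := (Real.Gamma_pos_of_pos (by positivity)).ne'
  unfold jF
  rw [show α / 2 - ((e + 1 : ℤ) : ℝ) + 1 = α / 2 - e by push_cast; ring,
    show α / 2 + ((e + 1 : ℤ) : ℝ) + 1 = (α / 2 + e + 1) + 1 by push_cast; ring,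
    Real.Gamma_add_one a1, Real.Gamma_add_one a2, zpow_add_one₀ (by norm_num)]
  generalize Real.Gamma (α / 2 - e) = A at *
  generalize Real.Gamma (α / 2 + e + 1) = B at *
  generalize α / 2 - (e : ℝ) = D at *
  generalize α / 2 + (e : ℝ) + 1 = E at *
  field_simp

theorem jp_zero (α : ℝ) : jp α 0 = 1 := by simp [jp, jc_zero]

theorem row_zero (α : ℝ) (h0 : 0 < α) (h2 : α < 2) (k : ℕ) :
    jI α (jp α (2 * k)) = jF α k k := by
  induction k with
  | zero =>
    have b := (Real.Gamma_pos_of_pos (show 0 < α / 2 + 1 by linarith)).ne'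
    rw [Nat.mul_zero, jp_zero, jI_zero α h0, jF]
    simp only [Nat.cast_zero, Int.cast_zero, zpow_zero, sub_zero, add_zero, zero_add]
    rw [add_comm (3 / 2) α]
    field_simp
  | succ k ih =>
    have e1 := congrArg (jI α) (jp_rec α h0 (2 * k + 1))
    have e2 := congrArg (jI α) (jp_der α h0 (2 * k + 1))
    rw [jI_parts α h0] at e2
    rw [jI_sub α h0] at e2
    rw [jI_add α h0] at e1
    simp only [jI_C, Nat.add_sub_cancel, ih] at e1 e2
    rw [show 2 * (k + 1) = 2 * k + 1 + 1 by ring]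
    have ee : (((k + 1 : ℕ) : ℤ)) = (k : ℤ) + 1 := by push_cast; ring
    rw [ee, jF_e α h0 h2, jF_k α h0 h2]
    push_cast at e1 e2 ⊢
    generalize jI α ((1 - 2 * Polynomial.X) * jp α (2 * k + 1)) = Y at *
    generalize jI α (jp α (2 * k + 1 + 1)) = Z at *
    generalize jF α k k = W at *
    have c1 : (2 * (k : ℝ) + 1 + 2 * (α + 1)) ≠ 0 := by positivity
    have c2 : (2 * (k : ℝ) + 1 + α + 1) ≠ 0 := by positivity
    have c3 : (k : ℝ) + 3 / 2 + α ≠ 0 := by positivity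
    have c4 : α / 2 + (k : ℝ) + 1 ≠ 0 := by positivity
    have hY : Y = (2 * k + 1) * W / (2 * k + 1 + 2 * (α + 1)) := by
      rw [eq_div_iff c1]; linarith
    have hZ : Z = ((2 * (2 * k + 1) + α + 1) * Y - (2 * k + 1) * W) / (2 * k + 1 + α + 1) := by
      rw [eq_div_iff c2]; linarith
    rw [hZ, hY]
    have c5 : (2 * (k : ℝ) + 3 + 2 * α) ≠ 0 := by positivity
    field_simp
    ring

theorem jx (α : ℝ) (h0 : 0 < α) (m : ℕ) (g : Polynomial ℝ) :
    (2 * m + α + 1) * jI α ((1 - 2 * Polynomial.X) * jp α m * g) =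
      (m + α + 1) * jI α (jp α (m + 1) * g) + m * jI α (jp α (m - 1) * g) := by
  have e1 := congrArg (fun p => jI α (p * g)) (jp_rec α h0 m)
  simpa only [add_mul, jI_add α h0, mul_assoc, jI_C] using e1

theorem main_aux (α : ℝ) (h0 : 0 < α) (h2 : α < 2) (n : ℕ) : ∀ (m k : ℕ) (e : ℤ),
    m + n = 2 * k → (m : ℤ) - n = 2 * e → jI α (jp α m * jp α n) = jF α k e := by
  induction n using Nat.strong_induction_on with
  | _ n ih =>
  intro m k e hk he
  rcases n with _ | n
  · have hm : m = 2 * k := by omega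
    have : e = k := by omega
    rw [jp_zero, mul_one, hm, this, row_zero α h0 h2]
  · obtain ⟨k, rfl⟩ : ∃ j, k = j + 1 := ⟨k - 1, by omega⟩
    have e1 := jx α h0 m (jp α n)
    have e2 := jx α h0 n (jp α m)
    have hc : (1 - 2 * Polynomial.X) * jp α n * jp α m =
      (1 - 2 * Polynomial.X) * jp α m * jp α n := by ring
    rw [hc, mul_comm (jp α (n + 1)), mul_comm (jp α (n - 1))] at e2
    rw [ih n (by omega) (m + 1) (k + 1) (e + 1) (by omega) (by omega)] at e1
    have e3 : (m : ℝ) * jI α (jp α (m - 1) * jp α n) = m * jF α k e := by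
      rcases m with _ | m
      · simp
      · rw [Nat.add_sub_cancel, ih n (by omega) m k e (by omega) (by omega)]
    have e4 : (n : ℝ) * jI α (jp α m * jp α (n - 1)) = n * jF α k (e + 1) := by
      rcases n with _ | n
      · simp
      · rw [Nat.add_sub_cancel, ih n (by omega) m k (e + 1) (by omega) (by omega)]
    rw [e3] at e1
    rw [e4] at e2
    rw [jF_k α h0 h2, jF_e α h0 h2] at e1
    rw [jF_e α h0 h2] at e2
    rw [jF_k α h0 h2]
    have hm : (m : ℝ) = k + e + 1 := by
      have : (m : ℤ) = k + e + 1 := by omega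
      exact_mod_cast this
    have hn : (n : ℝ) = k - e := by
      have : (n : ℤ) = k - e := by omega
      exact_mod_cast this
    have d1 : (2 * (m : ℝ) + α + 1) ≠ 0 := by positivity
    have d2 : (2 * (n : ℝ) + α + 1) ≠ 0 := by positivity
    have d3 : ((n : ℝ) + α + 1) ≠ 0 := by positivity
    have d4 : (k : ℝ) + 3 / 2 + α ≠ 0 := by positivity
    have d5 : α / 2 + e + 1 ≠ 0 := by
      have := half_ne α h0 h2 (e + 1); push_cast at this; rwa [add_assoc]
    generalize jI α ((1 - 2 * Polynomial.X) * jp α m * jp α n) = Y at *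
    generalize jI α (jp α m * jp α (n + 1)) = Z at *
    generalize jF α k e = W at *
    rw [mul_comm, ← eq_div_iff d1] at e1
    have e5 : Z = ((2 * n + α + 1) * Y - n * (-W * ((α / 2 - e) / (α / 2 + e + 1)))) /
        (n + α + 1) := by
      rw [eq_div_iff d3]; linarith
    rw [e5, e1]
    rw [hm] at d1 ⊢
    rw [hn] at d2 d3 ⊢
    have d6 : α + 2 * e + 2 ≠ 0 := by intro h; apply d5; linarith
    have d7 : 2 * (k : ℝ) + 3 + 2 * α ≠ 0 := by positivity
    field_simp
    ring

/-- For `m = 2r`, `n = 2s` even,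
`b_{mn} = (-1)^{(m-n)/2} Γ(α+1) Γ((m+n+1)/2) Γ(α/2+1)²
  / (Γ((α-m+n)/2+1) Γ((α-n+m)/2+1) Γ((m+n+3)/2+α))`.
(`Real.Gamma` vanishes at nonpositive integers and division by zero is zero, implementing
the convention that a Gamma pole in the denominator makes the expression zero.) -/
theorem b_even_formula (α : ℝ) (hα : α ∈ Set.Ioo (0 : ℝ) 2) (r s m n : ℕ)
    (hm : m = 2 * r) (hn : n = 2 * s) :
    ∫ x in (-1 : ℝ)..1,
        (1 - x ^ 2) ^ α * jacobiP (α / 2) (α / 2) m x * jacobiP (α / 2) (α / 2) n x =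
      (-1 : ℝ) ^ ((r : ℤ) - s) * Real.Gamma (α + 1) * Real.Gamma (((m : ℝ) + n + 1) / 2) *
          Real.Gamma (α / 2 + 1) ^ 2 /
        (Real.Gamma ((α - m + n) / 2 + 1) * Real.Gamma ((α - n + m) / 2 + 1) *
          Real.Gamma (((m : ℝ) + n + 3) / 2 + α)) := by
  obtain ⟨h0, h2⟩ := hα
  have h := main_aux α h0 h2 n m (r + s) ((r : ℤ) - s) (by omega) (by omega)
  have hL : ∫ x in (-1 : ℝ)..1,
        (1 - x ^ 2) ^ α * jacobiP (α / 2) (α / 2) m x * jacobiP (α / 2) (α / 2) n x =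
      jI α (jp α m * jp α n) := by
    unfold jI
    congr 1; ext x
    rw [Polynomial.eval_mul, jp_eval, jp_eval, mul_assoc]
  rw [hL, h, jF]
  subst hm hn
  push_cast
  rw [show (2 * (r : ℝ) + 2 * s + 1) / 2 = r + s + 1 / 2 by ring,
    show (2 * (r : ℝ) + 2 * s + 3) / 2 + α = r + s + 3 / 2 + α by ring,
    show (α - 2 * (r : ℝ) + 2 * s) / 2 + 1 = α / 2 - (r - s) + 1 by ring,
    show (α - 2 * (s : ℝ) + 2 * r) / 2 + 1 = α / 2 + (r - s) + 1 by ring]
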